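/- Fix ε > 0. There is no family V of continuous functions ℝ → ℝ such that for all x, y ∈ ℝ: x > y + ε if and only if (v(x) ≥ v(y) for every v ∈ V) and (v(x) > v(y) for some v ∈ V). -/

import Mathlib

/-- The strict semiorder `x > y + ε` on `ℝ` admits no continuous Pareto
multi-utility representation. -/
theorem no_continuous_pareto_embedding (ε : ℝ) (hε : 0 < ε) :
    ¬ ∃ V : Set (ℝ → ℝ), (∀ v ∈ V, Continuous v) ∧
      ∀ x y : ℝ, x > y + ε ↔ (∀ v ∈ V, v x ≥ v y) ∧ (∃ v ∈ V, v x > v y) := by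
  rintro ⟨V, hcont, hV⟩
  -- By continuity every `v ∈ V` weakly increases from `y` to `y + ε`.
  have hle : ∀ y, ∀ v ∈ V, v y ≤ v (y + ε) := fun y v hv =>
    ge_of_tendsto ((hcont v hv).continuousWithinAt (s := Set.Ioi (y + ε)))
      (Filter.eventually_of_mem self_mem_nhdsWithin fun x hx => ((hV x y).1 hx).1 v hv)
  -- Since `y + ε` is not strictly above `y`, every `v ∈ V` is `ε`-periodic.
  have hper : ∀ y, ∀ v ∈ V, v (y + ε) ≤ v y := fun y v hv =>
    not_lt.1 fun h => lt_irrefl _ ((hV (y + ε) y).2 ⟨hle y, v, hv, h⟩)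
  obtain ⟨v, hv, hlt⟩ := ((hV (0 + ε + ε) 0).1 (by linarith)).2
  exact absurd hlt (not_lt.2 ((hper (0 + ε) v hv).trans (hper 0 v hv)))
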